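/- arXiv:2012.15660 — 4 statements merged into one kernel-verified Lean document; each statement's English description precedes it below -/
import Mathlib

section
/- If moreover ι : V → H is a compact operator, then there exists a bounded linear operator T₀ : H → V with a(T₀ f, v) = ⟪f, ι v⟫_H for all f ∈ H, v ∈ V, and the solution operator T := ι ∘ T₀ : H → H is a compact self-adjoint operator. -/
open scoped RealInnerProductSpace

/-- If `ι : V → H` is moreover a compact operator, then there is a
bounded solution operator `T₀ : H → V` with `a (T₀ f) v = ⟪f, ι v⟫` for all
`f, v`, and `T = ι ∘ T₀ : H → H` is a compact self-adjoint operator. -/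
theorem solution_operator_compact_selfAdjoint
    {V H : Type*}
    [NormedAddCommGroup V] [InnerProductSpace ℝ V] [CompleteSpace V]
    [NormedAddCommGroup H] [InnerProductSpace ℝ H] [CompleteSpace H]
    (ι : V →L[ℝ] H) (hι : IsCompactOperator ι)
    (a : V →L[ℝ] V →L[ℝ] ℝ)
    (hasymm : ∀ u v : V, a u v = a v u)
    (α : ℝ) (hα : 0 < α)
    (hcoer : ∀ v : V, α * ‖v‖ ^ 2 ≤ a v v) :
    ∃ T₀ : H →L[ℝ] V,
      (∀ (f : H) (v : V), a (T₀ f) v = ⟪f, ι v⟫) ∧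
      IsCompactOperator (ι.comp T₀) ∧
      ∀ f g : H, ⟪(ι.comp T₀) f, g⟫ = ⟪f, (ι.comp T₀) g⟫ := by
  have hcoercive : IsCoercive a :=
    ⟨α, hα, fun v => by simpa only [pow_two, mul_assoc] using hcoer v⟩
  let A := hcoercive.continuousLinearEquivOfBilin
  let T₀ : H →L[ℝ] V := (A.symm : V →L[ℝ] V).comp (ContinuousLinearMap.adjoint ι)
  have hT₀ : ∀ (f : H) (v : V), a (T₀ f) v = ⟪f, ι v⟫ := fun f v => by
    rw [← hcoercive.continuousLinearEquivOfBilin_apply, ← ContinuousLinearMap.adjoint_inner_left]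
    exact congrArg (fun w => ⟪w, v⟫) (A.apply_symm_apply _)
  refine ⟨T₀, hT₀, hι.comp_clm T₀, fun f g => ?_⟩
  calc
    ⟪ι (T₀ f), g⟫ = a (T₀ g) (T₀ f) := by rw [real_inner_comm, hT₀]
    _ = a (T₀ f) (T₀ g) := hasymm _ _
    _ = ⟪f, ι (T₀ g)⟫ := hT₀ f _
end

section
/- For every μ in the spectrum of S there exists ν in the spectrum of T such that |μ − ν| ≤ ‖S − T‖, where ‖·‖ is the operator norm; in particular the spectra of two self-adjoint operators lie within operator-norm distance of each other. -/
/-- In a C⋆-algebra, every point of the spectrum of `a` lies within distance `‖a - b‖` of the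
spectrum of `b`, provided `b` is normal. -/
theorem exists_mem_spectrum_norm_sub_le {A : Type*} [CStarAlgebra A] {a b : A}
    (hb : IsStarNormal b) {μ : ℂ} (hμ : μ ∈ spectrum ℂ a) :
    ∃ ν ∈ spectrum ℂ b, ‖μ - ν‖ ≤ ‖a - b‖ := by
  rcases eq_or_ne a b with rfl | hab
  · exact ⟨μ, hμ, by simp⟩
  by_contra! h
  have : Nontrivial A := ⟨a, b, hab⟩
  have hpos : 0 < ‖a - b‖ := norm_pos_iff.mpr (sub_ne_zero.mpr hab)
  have hne : ∀ ν ∈ spectrum ℂ b, μ - ν ≠ 0 := fun ν hν ↦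
    norm_pos_iff.mp (hpos.trans (h ν hν))
  let u : Aˣ := cfcUnits (fun z ↦ μ - z) b hne
  have hu : (u : A) = algebraMap ℂ A μ - b := by
    change cfc (fun z ↦ μ - z) b = _
    rw [cfc_sub (fun _ ↦ μ) (fun z ↦ z) b, cfc_const μ b, cfc_id' ℂ b]
  have hinv : ‖(↑u⁻¹ : A)‖ < ‖a - b‖⁻¹ := by
    change ‖cfc (fun z ↦ (μ - z)⁻¹) b‖ < _
    refine norm_cfc_lt (inv_pos.mpr hpos) fun ν hν ↦ ?_
    rw [norm_inv]
    exact inv_strictAnti₀ hpos (h ν hν)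
  have hclose : ‖(algebraMap ℂ A μ - a) - u‖ < ‖(↑u⁻¹ : A)‖⁻¹ := by
    rw [hu, sub_sub_sub_cancel_left, norm_sub_rev]
    exact (lt_inv_comm₀ (Units.norm_pos _) hpos).mp hinv
  exact spectrum.mem_iff.mp hμ (u.ofNearby _ hclose).isUnit

/-- The spectra of two bounded self-adjoint operators on a
nontrivial complex Hilbert space lie within operator-norm distance of each
other: for every `μ ∈ spectrum S` there is `ν ∈ spectrum T` with
`‖μ - ν‖ ≤ ‖S - T‖`. -/
theorem spectrum_dist_le_opNorm
    {H : Type*} [NormedAddCommGroup H] [InnerProductSpace ℂ H]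
    [CompleteSpace H] [Nontrivial H]
    (S T : H →L[ℂ] H)
    (hS : IsSelfAdjoint S) (hT : IsSelfAdjoint T) :
    ∀ μ ∈ spectrum ℂ S, ∃ ν ∈ spectrum ℂ T, ‖μ - ν‖ ≤ ‖S - T‖ := by
  intro μ hμ
  exact exists_mem_spectrum_norm_sub_le hT.isStarNormal hμ
end

section
/- First Strang lemma: for every v_h ∈ V_h and all constants δ₁, δ₂ ≥ 0 such that |a(v_h, w_h) − a_h(v_h, w_h)| ≤ δ₁‖w_h‖ and |f(w_h) − f_h(w_h)| ≤ δ₂‖w_h‖ for all w_h ∈ V_h, one has ‖u − u_h‖ ≤ (1 + M_a/α_*)·‖u − v_h‖ + (δ₁ + δ₂)/α_*. -/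
/-- First Strang lemma. If `u` solves `a u v = f v` on `V`,
`u_h ∈ V_h` solves `a_h u_h v_h = f_h v_h` on `V_h`, `a` is bounded with
constant `M_a` and `a_h` is coercive on `V_h` with constant `α_*`, then for
every `v_h ∈ V_h` and all `δ₁, δ₂ ≥ 0` bounding the consistency errors of the
forms, `‖u - u_h‖ ≤ (1 + M_a/α_*) ‖u - v_h‖ + (δ₁ + δ₂)/α_*`. -/
theorem first_strang_lemma
    {V : Type*} [NormedAddCommGroup V] [InnerProductSpace ℝ V] [CompleteSpace V]
    (Vh : Submodule ℝ V)
    (a : V →ₗ[ℝ] V →ₗ[ℝ] ℝ) (Ma : ℝ)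
    (ha : ∀ u v : V, |a u v| ≤ Ma * ‖u‖ * ‖v‖)
    (ah : Vh →ₗ[ℝ] Vh →ₗ[ℝ] ℝ) (αs : ℝ) (hαs : 0 < αs)
    (hcoer : ∀ v : Vh, αs * ‖v‖ ^ 2 ≤ ah v v)
    (f : V →ₗ[ℝ] ℝ) (fh : Vh →ₗ[ℝ] ℝ)
    (u : V) (hu : ∀ v : V, a u v = f v)
    (uh : Vh) (huh : ∀ vh : Vh, ah uh vh = fh vh) :
    ∀ (vh : Vh) (δ₁ δ₂ : ℝ), 0 ≤ δ₁ → 0 ≤ δ₂ →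
      (∀ wh : Vh, |a (vh : V) (wh : V) - ah vh wh| ≤ δ₁ * ‖wh‖) →
      (∀ wh : Vh, |f (wh : V) - fh wh| ≤ δ₂ * ‖wh‖) →
      ‖u - (uh : V)‖ ≤ (1 + Ma / αs) * ‖u - (vh : V)‖ + (δ₁ + δ₂) / αs := by
  intro vh δ₁ δ₂ hδ₁ hδ₂ h₁ h₂
  set w : Vh := uh - vh with hw
  have hMa : 0 ≤ Ma * ‖u - (vh : V)‖ := by
    rcases (norm_nonneg (u - (vh : V))).eq_or_lt with h | h
    · simp [← h]
    · exact nonneg_of_mul_nonneg_left ((abs_nonneg _).trans (ha _ _)) h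
  have hkey : αs * ‖w‖ ^ 2 ≤ (Ma * ‖u - (vh : V)‖ + (δ₁ + δ₂)) * ‖w‖ := by
    have hsplit : ah w w = (fh w - f w) + a (u - vh) w + (a vh w - ah vh w) := by
      have hdiff : ah w w = ah uh w - ah vh w := LinearMap.map_sub₂ ah uh vh w
      rw [hdiff, huh, LinearMap.map_sub₂, hu]
      ring
    have hbound := (abs_le.mp (ha (u - vh) w)).2
    rw [Submodule.norm_coe] at hbound
    linarith [hcoer w, (abs_le.mp (h₁ w)).2, (abs_le.mp (h₂ w)).1]
  have hdiscrete : ‖w‖ ≤ (Ma * ‖u - (vh : V)‖ + (δ₁ + δ₂)) / αs := by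
    rw [le_div_iff₀ hαs]
    rcases (norm_nonneg w).eq_or_lt with h | h
    · rw [← h]
      linarith
    · exact le_of_mul_le_mul_right (by linarith) h
  calc ‖u - (uh : V)‖ = ‖(u - (vh : V)) - (w : V)‖ := by simp [hw]
    _ ≤ ‖u - (vh : V)‖ + ‖w‖ := norm_sub_le _ _
    _ ≤ ‖u - (vh : V)‖ + (Ma * ‖u - (vh : V)‖ + (δ₁ + δ₂)) / αs := by gcongr
    _ = (1 + Ma / αs) * ‖u - (vh : V)‖ + (δ₁ + δ₂) / αs := by ring
end

section
/- For every β > 0 the stabilized mass matrix M = M₁ + β·M₂ is positive definite, i.e. vᵀ(M₁ + βM₂)v > 0 for every nonzero v ∈ ℝⁿ. -/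
open Matrix

/-- For every `β > 0` the stabilized mass matrix `M₁ + β M₂` is
positive definite, where `M₁` is symmetric positive semidefinite and `M₂` is
symmetric positive semidefinite and positive definite on the kernel of `M₁`. -/
theorem stabilized_mass_matrix_posDef
    {n : Type*} [Fintype n] [Nonempty n] [DecidableEq n]
    (M₁ M₂ : Matrix n n ℝ)
    (hM₁symm : M₁.IsSymm) (hM₂symm : M₂.IsSymm)
    (hM₁ : ∀ v : n → ℝ, 0 ≤ v ⬝ᵥ M₁.mulVec v)
    (hM₂ : ∀ v : n → ℝ, 0 ≤ v ⬝ᵥ M₂.mulVec v)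
    (hM₂ker : ∀ v : n → ℝ, v ≠ 0 → M₁.mulVec v = 0 → 0 < v ⬝ᵥ M₂.mulVec v) :
    ∀ β : ℝ, 0 < β → ∀ v : n → ℝ, v ≠ 0 →
      0 < v ⬝ᵥ (M₁ + β • M₂).mulVec v := by
  intro β hβ v hv
  have h_psd : M₁.PosSemidef :=
    .of_dotProduct_mulVec_nonneg (by simpa [IsHermitian] using hM₁symm.eq)
      (by simpa using hM₁)
  rw [add_mulVec, smul_mulVec, dotProduct_add, dotProduct_smul, smul_eq_mul]
  by_cases h_ker : M₁.mulVec v = 0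
  · exact add_pos_of_nonneg_of_pos (hM₁ v) (mul_pos hβ (hM₂ker v hv h_ker))
  · have h_ne : v ⬝ᵥ M₁.mulVec v ≠ 0 := fun h ↦
      h_ker ((h_psd.dotProduct_mulVec_zero_iff v).mp (by simpa using h))
    exact add_pos_of_pos_of_nonneg ((hM₁ v).lt_of_ne' h_ne) (mul_nonneg hβ.le (hM₂ v))
end
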